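/- Let G be a group acting by homeomorphisms on a locally compact Hausdorff topological space M. Assume the action is proper in the sense that for every compact subset K ⊆ M the set {h ∈ G : hK ∩ K ≠ ∅} is finite, and cocompact in the sense that the orbit space G\M with the quotient topology is compact. Then for every g ∈ G, the centralizer Z_G(g) = {z ∈ G : zg = gz} preserves the fixed-point set M^g = {x ∈ M : g·x = x}, and the quotient space Z_G(g)\M^g of M^g by the induced Z_G(g)-action, with the quotient topology, is compact. -/

import Mathlib

open scoped Pointwise

/-- A locally compact space with compact orbit space contains a compact set meeting every orbit. -/
theorem exists_isCompact_forall_exists_smul_mem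
    {G M : Type*} [Group G] [TopologicalSpace M] [LocallyCompactSpace M] [MulAction G M]
    [ContinuousConstSMul G M] [CompactSpace (Quotient (MulAction.orbitRel G M))] :
    ∃ K : Set M, IsCompact K ∧ ∀ x : M, ∃ h : G, h • x ∈ K := by
  choose C hC hCx using fun x : M => exists_compact_mem_nhds x
  let π : M → Quotient (MulAction.orbitRel G M) := Quotient.mk _
  have hπ : IsOpenMap π := isOpenMap_quotient_mk'_mul
  obtain ⟨t, -, ht⟩ := isCompact_univ.elim_nhds_subcover (fun q => π '' C q.out) fun q _ => by
    have hq := hπ.image_mem_nhds (hCx q.out)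
    rwa [show π q.out = q from Quotient.out_eq q] at hq
  refine ⟨⋃ q ∈ t, C q.out, t.isCompact_biUnion fun q _ => hC _, fun x => ?_⟩
  obtain ⟨q, hq, k, hk, hkx⟩ := Set.mem_iUnion₂.1 (ht (Set.mem_univ (π x)))
  obtain ⟨h, hh⟩ := MulAction.orbitRel_apply.1 (Quotient.exact hkx)
  exact ⟨h, Set.mem_iUnion₂.2 ⟨q, hq, Set.mem_of_eq_of_mem hh hk⟩⟩

/-- If a compact set `K` meets every orbit of a proper action, then finitely many translates of `K`
meet every orbit of the centralizer of `g` on the fixed points of `g`. -/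
theorem exists_isCompact_forall_exists_centralizer_smul_mem
    {G M : Type*} [Group G] [TopologicalSpace M] [MulAction G M] [ContinuousConstSMul G M]
    {K : Set M} (hK : IsCompact K) (hfin : {h : G | (h • K) ∩ K ≠ ∅}.Finite)
    (hcover : ∀ x : M, ∃ h : G, h • x ∈ K) (g : G) :
    ∃ L : Set M, IsCompact L ∧ ∀ x ∈ MulAction.fixedBy M g,
      ∃ z ∈ Subgroup.centralizer ({g} : Set G), z • x ∈ L := by
  have hconj : ∀ f : G, ∃ c : G, (∃ h : G, h * g * h⁻¹ = f) → c * g * c⁻¹ = f := fun f => by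
    by_cases hf : ∃ h : G, h * g * h⁻¹ = f
    · exact ⟨hf.choose, fun _ => hf.choose_spec⟩
    · exact ⟨1, fun h => (hf h).elim⟩
  choose c hc using hconj
  refine ⟨⋃ f ∈ {h : G | (h • K) ∩ K ≠ ∅}, (c f)⁻¹ • K,
    hfin.isCompact_biUnion fun f _ => hK.smul _, fun x hx => ?_⟩
  obtain ⟨h, hh⟩ := hcover x
  have hcf := hc (h * g * h⁻¹) ⟨h, rfl⟩
  refine ⟨(c (h * g * h⁻¹))⁻¹ * h, ?_, Set.mem_iUnion₂.2 ⟨h * g * h⁻¹, ?_, ?_⟩⟩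
  · generalize c (h * g * h⁻¹) = d at hcf
    rw [Subgroup.mem_centralizer_singleton_iff]
    have hd : d * g = h * g * h⁻¹ * d := by rw [← hcf]; group
    apply mul_left_cancel (a := d)
    calc d * (d⁻¹ * h * g) = h * g := by group
      _ = (h * g * h⁻¹ * d) * d⁻¹ * h := by group
      _ = d * (g * (d⁻¹ * h)) := by rw [← hd]; group
  · refine Set.Nonempty.ne_empty ⟨h • x, ⟨h • x, hh, ?_⟩, hh⟩
    change (h * g * h⁻¹) • h • x = h • x
    rw [smul_smul, inv_mul_cancel_right, mul_smul, MulAction.mem_fixedBy.1 hx]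
  · rw [mul_smul]
    exact Set.smul_mem_smul_set hh

/-- Let a group `G` act by homeomorphisms on a locally compact Hausdorff
space `M`, properly (for every compact `K ⊆ M` the set `{h : hK ∩ K ≠ ∅}` is finite) and
cocompactly (the orbit space `G\M` is compact). Then for every `g ∈ G` the centralizer
`Z_G(g)` preserves the fixed-point set `M^g`, and the quotient `Z_G(g)\M^g` (with the
quotient topology) is compact. -/
theorem quotient_of_fixedPointSet_by_centralizer_compact
    {G M : Type*} [Group G] [TopologicalSpace M] [T2Space M] [LocallyCompactSpace M]
    [MulAction G M]
    (hcont : ∀ h : G, Continuous fun x : M => h • x)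
    (hproper : ∀ K : Set M, IsCompact K → {h : G | (h • K) ∩ K ≠ ∅}.Finite)
    (hcocompact : CompactSpace (Quotient (MulAction.orbitRel G M))) :
    ∀ g : G,
      (∀ z ∈ Subgroup.centralizer ({g} : Set G), ∀ x ∈ MulAction.fixedBy M g,
          z • x ∈ MulAction.fixedBy M g) ∧
      CompactSpace (Quot fun x y : MulAction.fixedBy M g =>
        ∃ z ∈ Subgroup.centralizer ({g} : Set G), z • (x : M) = (y : M)) := by
  intro g
  have : ContinuousConstSMul G M := ⟨hcont⟩
  have hpres : ∀ z ∈ Subgroup.centralizer ({g} : Set G), ∀ x ∈ MulAction.fixedBy M g,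
      z • x ∈ MulAction.fixedBy M g := fun z hz x hx => by
    rw [MulAction.mem_fixedBy, smul_smul, ← Subgroup.mem_centralizer_singleton_iff.1 hz, mul_smul,
      MulAction.mem_fixedBy.1 hx]
  refine ⟨hpres, ?_⟩
  obtain ⟨K, hK, hcover⟩ := exists_isCompact_forall_exists_smul_mem (G := G) (M := M)
  obtain ⟨L, hL, hLcover⟩ :=
    exists_isCompact_forall_exists_centralizer_smul_mem hK (hproper K hK) hcover g
  have hclosed : IsClosed (MulAction.fixedBy M g) := isClosed_eq (hcont g) continuous_id
  have hL' : IsCompact ((↑) ⁻¹' L : Set (MulAction.fixedBy M g)) :=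
    hclosed.isClosedEmbedding_subtypeVal.isCompact_preimage hL
  refine ⟨(hL'.image continuous_quot_mk).of_isClosed_subset isClosed_univ ?_⟩
  rintro ⟨x, hx⟩ -
  obtain ⟨z, hz, hzx⟩ := hLcover x hx
  exact ⟨⟨z • x, hpres z hz x hx⟩, hzx, (Quot.sound ⟨z, hz, rfl⟩).symm⟩
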